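/- arXiv:math/0610673 — 2 statements merged into one kernel-verified Lean document; each statement's English description precedes it below -/
import Mathlib

section
/- Let y be a solution of the sixth Painlevé equation PVI(α,β,γ,δ) on an open set U ⊆ ℂ∖{0,1} with y(t) ∉ {0,1,t} for all t ∈ U. Define ỹ on the set {1/(1−t) : t ∈ U} by ỹ(1/(1−t)) = 1/(1−y(t)). Then ỹ is a solution of PVI(γ,−α,−β,δ). In particular, if α = −β = γ, then ỹ solves the same equation PVI(α,β,γ,δ). -/
/-- The right-hand side of the sixth Painlevé equation PVI(α,β,γ,δ),
as a function of `y`, `y'` and `t`. -/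
noncomputable def pviRHS (a b c d : ℂ) (y y' t : ℂ) : ℂ :=
  (1 / 2) * (1 / y + 1 / (y - 1) + 1 / (y - t)) * y' ^ 2
    - (1 / t + 1 / (t - 1) + 1 / (y - t)) * y'
    + (y * (y - 1) * (y - t) / (t ^ 2 * (t - 1) ^ 2)) *
      (a + b * t / y ^ 2 + c * (t - 1) / (y - 1) ^ 2 + d * t * (t - 1) / (y - t) ^ 2)

/-- `y` is a (twice differentiable) solution of PVI(α,β,γ,δ) on `U`. -/
def IsPVISol (a b c d : ℂ) (U : Set ℂ) (y : ℂ → ℂ) : Prop :=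
  (∀ t ∈ U, DifferentiableAt ℂ y t ∧ DifferentiableAt ℂ (deriv y) t) ∧
    ∀ t ∈ U, deriv (deriv y) t = pviRHS a b c d (y t) (deriv y t) t

/-- The pullback of the right-hand side of PVI(α,β,γ,δ) along `t ↦ 1/(1-t)`, `y ↦ 1/(1-y)`:
the right-hand side of PVI(γ,−α,−β,δ) in terms of the original variables. -/
theorem pviRHS_one_div_one_sub (a b c d : ℂ) {t y : ℂ} (p : ℂ) (ht0 : t ≠ 0) (ht1 : t ≠ 1)
    (hy0 : y ≠ 0) (hy1 : y ≠ 1) (hyt : y ≠ t) :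
    pviRHS c (-a) (-b) d (1 / (1 - y)) (p * (1 - t) ^ 2 / (1 - y) ^ 2) (1 / (1 - t)) =
      pviRHS a b c d y p t * (1 - t) ^ 4 / (1 - y) ^ 2
        + 2 * p ^ 2 * (1 - t) ^ 4 / (1 - y) ^ 3 - 2 * p * (1 - t) ^ 3 / (1 - y) ^ 2 := by
  have h1 : 1 - t ≠ 0 := sub_ne_zero.mpr ht1.symm
  have h2 : 1 - y ≠ 0 := sub_ne_zero.mpr hy1.symm
  have h3 : y - t ≠ 0 := sub_ne_zero.mpr hyt
  have e1 : 1 / (1 - y) - 1 = y / (1 - y) := by field_simp; ring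
  have e2 : 1 / (1 - t) - 1 = t / (1 - t) := by field_simp; ring
  have e3 : 1 / (1 - y) - 1 / (1 - t) = (y - t) / ((1 - y) * (1 - t)) := by field_simp; ring
  have e4 : y - 1 = -(1 - y) := by ring
  have e5 : t - 1 = -(1 - t) := by ring
  unfold pviRHS
  rw [e1, e2, e3, e4, e5]
  field_simp
  ring

/-- The derivative of `s ↦ 1 - 1/s`. -/
theorem hasDerivAt_one_sub_one_div {s : ℂ} (hs : s ≠ 0) :
    HasDerivAt (fun s : ℂ => 1 - 1 / s) (1 / s ^ 2) s := by
  simpa [one_div] using (hasDerivAt_inv hs).const_sub 1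

/-- The chain rule for `s ↦ 1/(1 - y(1 - 1/s))`. -/
theorem hasDerivAt_one_div_one_sub_comp {y : ℂ → ℂ} {s : ℂ} (hs : s ≠ 0)
    (hy : DifferentiableAt ℂ y (1 - 1 / s)) (hy1 : y (1 - 1 / s) ≠ 1) :
    HasDerivAt (fun s => 1 / (1 - y (1 - 1 / s)))
      (deriv y (1 - 1 / s) * (1 / s ^ 2) / (1 - y (1 - 1 / s)) ^ 2) s := by
  have h := ((hy.hasDerivAt.comp s (hasDerivAt_one_sub_one_div hs)).const_sub 1).inv
    (sub_ne_zero.mpr hy1.symm)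
  simpa [Function.comp_def, Pi.inv_def, one_div] using h

theorem IsPVISol.one_div_one_sub {a b c d : ℂ} {U : Set ℂ} {y : ℂ → ℂ}
    (hy : IsPVISol a b c d U y) (hU : IsOpen U) (hU01 : ∀ t ∈ U, t ≠ 0 ∧ t ≠ 1)
    (hreg : ∀ t ∈ U, y t ≠ 0 ∧ y t ≠ 1 ∧ y t ≠ t) :
    IsPVISol c (-a) (-b) d ((fun t => 1 / (1 - t)) '' U)
      (fun s => 1 / (1 - y (1 - 1 / s))) := by
  suffices H : ∀ t ∈ U,
      HasDerivAt (fun s => 1 / (1 - y (1 - 1 / s)))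
        (deriv y t * (1 - t) ^ 2 / (1 - y t) ^ 2) (1 / (1 - t)) ∧
      HasDerivAt (deriv fun s => 1 / (1 - y (1 - 1 / s)))
        (deriv (deriv y) t * (1 - t) ^ 4 / (1 - y t) ^ 2
          + 2 * deriv y t ^ 2 * (1 - t) ^ 4 / (1 - y t) ^ 3
          - 2 * deriv y t * (1 - t) ^ 3 / (1 - y t) ^ 2) (1 / (1 - t)) by
    refine ⟨?_, ?_⟩ <;> rintro _ ⟨t, ht, rfl⟩
    · exact ⟨(H t ht).1.differentiableAt, (H t ht).2.differentiableAt⟩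
    · obtain ⟨hy0, hy1, hyt⟩ := hreg t ht
      dsimp only
      rw [(H t ht).1.deriv, (H t ht).2.deriv, hy.2 t ht, one_div_one_div, sub_sub_cancel,
        pviRHS_one_div_one_sub a b c d _ (hU01 t ht).1 (hU01 t ht).2 hy0 hy1 hyt]
  intro t ht
  have ht1 : 1 - t ≠ 0 := sub_ne_zero.mpr (hU01 t ht).2.symm
  have hy1 : 1 - y t ≠ 0 := sub_ne_zero.mpr (hreg t ht).2.1.symm
  have hs : 1 / (1 - t) ≠ 0 := one_div_ne_zero ht1
  have hst : 1 - 1 / (1 / (1 - t)) = t := by rw [one_div_one_div, sub_sub_cancel]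
  have hderiv : deriv (fun s => 1 / (1 - y (1 - 1 / s))) =ᶠ[nhds (1 / (1 - t))]
      fun s => deriv y (1 - 1 / s) * (1 / s ^ 2) / (1 - y (1 - 1 / s)) ^ 2 := by
    have hmem : ∀ᶠ s in nhds (1 / (1 - t)), 1 - 1 / s ∈ U :=
      (hasDerivAt_one_sub_one_div hs).continuousAt.eventually_mem
        (hU.mem_nhds (hst.symm ▸ ht))
    filter_upwards [hmem, eventually_ne_nhds hs] with s hsU hs0
    exact (hasDerivAt_one_div_one_sub_comp hs0 (hy.1 _ hsU).1 (hreg _ hsU).2.1).deriv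
  have hinner := hasDerivAt_one_sub_one_div hs
  constructor
  · have h := hasDerivAt_one_div_one_sub_comp hs (hst.symm ▸ (hy.1 t ht).1)
      (hst.symm ▸ (hreg t ht).2.1)
    rw [hst] at h
    refine h.congr_deriv ?_
    field_simp
  · have hY : HasDerivAt (fun s => y (1 - 1 / s)) (deriv y t * (1 / (1 / (1 - t)) ^ 2))
        (1 / (1 - t)) :=
      HasDerivAt.comp_of_eq _ (hy.1 t ht).1.hasDerivAt hinner hst.symm
    have hY' : HasDerivAt (fun s => deriv y (1 - 1 / s))
        (deriv (deriv y) t * (1 / (1 / (1 - t)) ^ 2)) (1 / (1 - t)) :=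
      HasDerivAt.comp_of_eq _ (hy.1 t ht).2.hasDerivAt hinner hst.symm
    have hpow : HasDerivAt (fun s : ℂ => 1 / s ^ 2) (-2 * (1 - t) ^ 3) (1 / (1 - t)) := by
      refine ((hasDerivAt_const _ 1).fun_div (hasDerivAt_pow 2 (1 / (1 - t)))
        (pow_ne_zero 2 hs)).congr_deriv ?_
      norm_num
      field_simp
    refine HasDerivAt.congr_of_eventuallyEq ?_ hderiv
    refine ((hY'.mul hpow).fun_div ((hY.const_sub 1).fun_pow 2)
      (pow_ne_zero 2 (by simpa only [hst] using hy1))).congr_deriv ?_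
    simp only [Pi.mul_apply, hst]
    field_simp
    ring

/-- **Bäcklund symmetry σ₂∘σ₁ of PVI.** If `y` solves PVI(α,β,γ,δ) on the open set
`U ⊆ ℂ∖{0,1}` with `y t ∉ {0, 1, t}` for all `t ∈ U`, then the function `ỹ` on
`{1/(1-t) : t ∈ U}` defined by `ỹ(1/(1-t)) = 1/(1 - y t)` (i.e. `ỹ(s) = 1/(1 - y(1 - 1/s))`)
solves PVI(γ,−α,−β,δ); in particular, if `α = −β = γ`, then `ỹ` solves the same
equation PVI(α,β,γ,δ). -/
theorem pvi_backlund_sigma2_sigma1 (a b c d : ℂ) (U : Set ℂ) (hU : IsOpen U)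
    (hU01 : ∀ t ∈ U, t ≠ 0 ∧ t ≠ 1) (y : ℂ → ℂ)
    (hy : IsPVISol a b c d U y)
    (hreg : ∀ t ∈ U, y t ≠ 0 ∧ y t ≠ 1 ∧ y t ≠ t) :
    IsPVISol c (-a) (-b) d ((fun t => 1 / (1 - t)) '' U)
        (fun s => 1 / (1 - y (1 - 1 / s))) ∧
      (a = -b ∧ -b = c →
        IsPVISol a b c d ((fun t => 1 / (1 - t)) '' U)
          (fun s => 1 / (1 - y (1 - 1 / s)))) := by
  have h := hy.one_div_one_sub hU hU01 hreg
  refine ⟨h, ?_⟩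
  rintro ⟨rfl, rfl⟩
  simpa only [neg_neg] using h
end

section
/- Let α₀,α₁,α₂,α₃,α₄ be complex parameters with α₀ + α₁ + 2α₂ + α₃ + α₄ = 1, and let (y,z) be a solution of the Hamiltonian system (9) on an open set U ⊆ ℂ∖{0,1} such that y(t) ∉ {0,1,t} for all t ∈ U. Then y solves the sixth Painlevé equation PVI(α,β,γ,δ) on U with α = α₁²/2, β = −α₄²/2, γ = α₃²/2, δ = (1−α₀²)/2. -/
/-- `(y, z)` is a (differentiable) solution of the Hamiltonian system (9) with
parameters `(a0, a1, a2, a3, a4)` on the set `U`. -/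
def IsHamSol (a0 a1 a2 a3 a4 : ℂ) (U : Set ℂ) (y z : ℂ → ℂ) : Prop :=
  ∀ t ∈ U, DifferentiableAt ℂ y t ∧ DifferentiableAt ℂ z t ∧
    t * (t - 1) * deriv y t =
      2 * y t * (y t - 1) * (y t - t) * z t - (a0 - 1) * y t * (y t - 1)
        - a3 * y t * (y t - t) - a4 * (y t - 1) * (y t - t) ∧
    t * (t - 1) * deriv z t =
      -(y t * (y t - 1) + (y t - 1) * (y t - t) + y t * (y t - t)) * z t ^ 2
        + ((2 * y t - 1) * (a0 - 1) + (2 * y t - t) * a3 + (2 * y t - t - 1) * a4) * z t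
        - (a1 + a2) * a2

/-- The algebraic identity behind the reduction: eliminating `z` from the derivative of the first
Hamiltonian equation gives the right-hand side of PVI. -/
theorem pviRHS_eq_of_hamiltonian {a0 a1 a2 a3 a4 t y z y' z' y'' : ℂ}
    (hsum : a0 + a1 + 2 * a2 + a3 + a4 = 1)
    (ht0 : t ≠ 0) (ht1 : t ≠ 1) (hy0 : y ≠ 0) (hy1 : y ≠ 1) (hyt : y ≠ t)
    (hy' : t * (t - 1) * y' =
      2 * y * (y - 1) * (y - t) * z - (a0 - 1) * y * (y - 1)
        - a3 * y * (y - t) - a4 * (y - 1) * (y - t))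
    (hz' : t * (t - 1) * z' =
      -(y * (y - 1) + (y - 1) * (y - t) + y * (y - t)) * z ^ 2
        + ((2 * y - 1) * (a0 - 1) + (2 * y - t) * a3 + (2 * y - t - 1) * a4) * z
        - (a1 + a2) * a2)
    (hy'' : (2 * t - 1) * y' + t * (t - 1) * y'' =
      2 * (y' * (y - 1) * (y - t) + y * y' * (y - t) + y * (y - 1) * (y' - 1)) * z
        + 2 * y * (y - 1) * (y - t) * z'
        - (a0 - 1) * (y' * (y - 1) + y * y')
        - a3 * (y' * (y - t) + y * (y' - 1))
        - a4 * (y' * (y - t) + (y - 1) * (y' - 1))) :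
    y'' = pviRHS (a1 ^ 2 / 2) (-a4 ^ 2 / 2) (a3 ^ 2 / 2) ((1 - a0 ^ 2) / 2) y y' t := by
  have h1 : t - 1 ≠ 0 := sub_ne_zero.2 ht1
  have h2 : y - 1 ≠ 0 := sub_ne_zero.2 hy1
  have h3 : y - t ≠ 0 := sub_ne_zero.2 hyt
  have hT : t * (t - 1) ≠ 0 := mul_ne_zero ht0 h1
  obtain rfl : a1 = 1 - a0 - 2 * a2 - a3 - a4 := by linear_combination hsum
  rw [mul_comm, ← eq_div_iff hT] at hy' hz'
  have hy2 := eq_sub_of_add_eq' hy''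
  rw [mul_comm, ← eq_div_iff hT] at hy2
  rw [hy2, hz', hy', pviRHS]
  field_simp
  ring

/-- **The Hamiltonian system (9) yields PVI.** If `α₀ + α₁ + 2α₂ + α₃ + α₄ = 1` and
`(y, z)` solves the Hamiltonian system (9) on the open set `U ⊆ ℂ∖{0,1}` with
`y t ∉ {0, 1, t}` on `U`, then `y` solves PVI(α,β,γ,δ) on `U` with
`α = α₁²/2`, `β = -α₄²/2`, `γ = α₃²/2`, `δ = (1-α₀²)/2`. -/
theorem ham_gives_pvi (a0 a1 a2 a3 a4 : ℂ)
    (hsum : a0 + a1 + 2 * a2 + a3 + a4 = 1)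
    (U : Set ℂ) (hU : IsOpen U) (hU01 : ∀ t ∈ U, t ≠ 0 ∧ t ≠ 1)
    (y z : ℂ → ℂ)
    (hyz : IsHamSol a0 a1 a2 a3 a4 U y z)
    (hreg : ∀ t ∈ U, y t ≠ 0 ∧ y t ≠ 1 ∧ y t ≠ t) :
    IsPVISol (a1 ^ 2 / 2) (-a4 ^ 2 / 2) (a3 ^ 2 / 2) ((1 - a0 ^ 2) / 2) U y := by
  have hy'' : ∀ t ∈ U, DifferentiableAt ℂ (deriv y) t ∧
      (2 * t - 1) * deriv y t + t * (t - 1) * deriv (deriv y) t =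
        2 * (deriv y t * (y t - 1) * (y t - t) + y t * deriv y t * (y t - t)
            + y t * (y t - 1) * (deriv y t - 1)) * z t
          + 2 * y t * (y t - 1) * (y t - t) * deriv z t
          - (a0 - 1) * (deriv y t * (y t - 1) + y t * deriv y t)
          - a3 * (deriv y t * (y t - t) + y t * (deriv y t - 1))
          - a4 * (deriv y t * (y t - t) + (y t - 1) * (deriv y t - 1)) := by
    intro t ht
    have hdy : DifferentiableAt ℂ (deriv y) t :=
      (DifferentiableOn.deriv (fun s hs => (hyz s hs).1.differentiableWithinAt) hU).differentiableAt
        (hU.mem_nhds ht)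
    refine ⟨hdy, ?_⟩
    have hy := (hyz t ht).1.hasDerivAt
    have hz := (hyz t ht).2.1.hasDerivAt
    have hid := hasDerivAt_id' t
    have hL := (hid.mul (hid.sub_const 1)).mul hdy.hasDerivAt
    have hyt := hy.sub hid
    have hR := ((((((hy.const_mul 2).mul (hy.sub_const 1)).mul hyt).mul hz).sub
      ((hy.const_mul (a0 - 1)).mul (hy.sub_const 1))).sub
      ((hy.const_mul a3).mul hyt)).sub (((hy.sub_const 1).const_mul a4).mul hyt)
    have hLR := hL.unique (hR.congr_of_eventuallyEq
      (Filter.eventually_of_mem (hU.mem_nhds ht) fun s hs => (hyz s hs).2.2.1))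
    simp only [Pi.mul_apply, Pi.sub_apply] at hLR
    linear_combination hLR
  refine ⟨fun t ht => ⟨(hyz t ht).1, (hy'' t ht).1⟩, fun t ht => ?_⟩
  obtain ⟨ht0, ht1⟩ := hU01 t ht
  obtain ⟨hy0, hy1, hyt⟩ := hreg t ht
  obtain ⟨-, -, hy', hz'⟩ := hyz t ht
  exact pviRHS_eq_of_hamiltonian hsum ht0 ht1 hy0 hy1 hyt hy' hz' (hy'' t ht).2
end
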